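/- arXiv:2110.06816 — 3 statements merged into one kernel-verified Lean document; each statement's English description precedes it below -/
import Mathlib

section
/- For any two probability distributions μ and ν on the n×m pixel grid, there exists at least one flow δ such that ν = Δ(μ, δ); that is, for fixed μ the map δ ↦ Δ(μ, δ) is surjective onto the set of probability distributions on X. -/
namespace WassersteinFlow

/-- A flow on the `n × m` grid: a pair `(δ→, δ↓)` with `δ→ ∈ ℝ^{n×(m-1)}`
and `δ↓ ∈ ℝ^{(n-1)×m}`. -/
abbrev Flow (n m : ℕ) := (Fin n → Fin (m - 1) → ℝ) × (Fin (n - 1) → Fin m → ℝ)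

/-- Entry access with out-of-range indices giving `0` (0-based indices). -/
def entry {a b : ℕ} (δ : Fin a → Fin b → ℝ) (i j : ℤ) : ℝ :=
  if h : 0 ≤ i ∧ i < (a : ℤ) ∧ 0 ≤ j ∧ j < (b : ℤ) then
    δ ⟨i.toNat, by omega⟩ ⟨j.toNat, by omega⟩
  else 0

/-- The flow application map `Δ`:
`Δ(μ,δ)_{i,j} = μ_{i,j} + δ↓_{i−1,j} + δ→_{i,j−1} − δ↓_{i,j} − δ→_{i,j}`,
with out-of-range entries taken to be `0`. -/
def applyFlow {n m : ℕ} (μ : Fin n × Fin m → ℝ) (δ : Flow n m) : Fin n × Fin m → ℝ :=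
  fun x =>
    μ x + entry δ.2 ((x.1 : ℤ) - 1) (x.2 : ℤ) + entry δ.1 (x.1 : ℤ) ((x.2 : ℤ) - 1)
      - entry δ.2 (x.1 : ℤ) (x.2 : ℤ) - entry δ.1 (x.1 : ℤ) (x.2 : ℤ)

/-- The `L¹`-norm of a flow: the sum of absolute values of all entries. -/
def flowL1 {n m : ℕ} (δ : Flow n m) : ℝ :=
  (∑ i, ∑ j, |δ.1 i j|) + (∑ i, ∑ j, |δ.2 i j|)

/-- A probability distribution on the grid. -/
def IsProbDist {n m : ℕ} (μ : Fin n × Fin m → ℝ) : Prop :=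
  (∀ x, 0 ≤ μ x) ∧ ∑ x, μ x = 1

/-- The `L¹` ground metric `d((i,j),(k,l)) = |i−k| + |j−l|` on the grid. -/
def gd {n m : ℕ} (x y : Fin n × Fin m) : ℝ :=
  ((|(x.1 : ℤ) - (y.1 : ℤ)| + |(x.2 : ℤ) - (y.2 : ℤ)| : ℤ) : ℝ)

/-- `π` is a coupling of `μ` and `ν`. -/
def IsCoupling {n m : ℕ} (μ ν : Fin n × Fin m → ℝ)
    (π : (Fin n × Fin m) × (Fin n × Fin m) → ℝ) : Prop :=
  (∀ p, 0 ≤ π p) ∧ (∀ x, ∑ y, π (x, y) = μ x) ∧ (∀ y, ∑ x, π (x, y) = ν y)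

/-- The 1-Wasserstein distance with `L¹` ground metric. -/
noncomputable def W1 {n m : ℕ} (μ ν : Fin n × Fin m → ℝ) : ℝ :=
  sInf {c | ∃ π, IsCoupling μ ν π ∧
    c = ∑ p : (Fin n × Fin m) × (Fin n × Fin m), gd p.1 p.2 * π p}

/-- Index type for flattened flows. -/
abbrev FlowIdx (n m : ℕ) := (Fin n × Fin (m - 1)) ⊕ (Fin (n - 1) × Fin m)

/-- Flatten a flow to a vector in `ℝ^{n(m−1)+(n−1)m}`. -/
def flat {n m : ℕ} (δ : Flow n m) : FlowIdx n m → ℝ :=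
  Sum.elim (fun p => δ.1 p.1 p.2) (fun p => δ.2 p.1 p.2)

/-- `f` extended by zero to `ℕ × ℕ`. -/
def extend {n m : ℕ} (f : Fin n × Fin m → ℝ) (i j : ℕ) : ℝ :=
  if h : i < n ∧ j < m then f (⟨i, h.1⟩, ⟨j, h.2⟩) else 0

lemma extend_val {n m : ℕ} (f : Fin n × Fin m → ℝ) (i : Fin n) (j : Fin m) :
    extend f i j = f (i, j) := by
  simp [extend]

lemma sum_extend {n m : ℕ} (f : Fin n × Fin m → ℝ) :
    ∑ i ∈ Finset.range n, ∑ j ∈ Finset.range m, extend f i j = ∑ x, f x := by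
  simp only [Finset.sum_range, extend_val, Fintype.sum_prod_type]

lemma entry_natCast {a b : ℕ} (g : ℕ → ℕ → ℝ) (i j : ℕ) :
    entry (fun (i : Fin a) (j : Fin b) => g i j) i j = if i < a ∧ j < b then g i j else 0 := by
  simp [entry]

lemma entry_sub_one_left {a b : ℕ} (g : ℕ → ℕ → ℝ) (i j : ℕ) (h : i - 1 < a ∨ i = 0)
    (hj : j < b) (h0 : g 0 j = 0) :
    entry (fun (i : Fin a) (j : Fin b) => g (i + 1) j) ((i : ℤ) - 1) j = g i j := by
  cases i with
  | zero => simp [entry, h0]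
  | succ i =>
    have hi : i < a := by omega
    simpa [hi, hj] using entry_natCast (a := a) (b := b) (fun i j => g (i + 1) j) i j

lemma entry_sub_one_right {a b : ℕ} (g : ℕ → ℕ → ℝ) (i j : ℕ) (h : j - 1 < b ∨ j = 0)
    (hi : i < a) (h0 : g i 0 = 0) :
    entry (fun (i : Fin a) (j : Fin b) => g i (j + 1)) i ((j : ℤ) - 1) = g i j := by
  cases j with
  | zero => simp [entry, h0]
  | succ j =>
    have hj : j < b := by omega
    simpa [hi, hj] using entry_natCast (a := a) (b := b) (fun i j => g i (j + 1)) i j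

/-- For any two probability distributions `μ`, `ν` there exists a flow `δ`
with `ν = Δ(μ, δ)`. -/
theorem exists_flow (n m : ℕ) (μ ν : Fin n × Fin m → ℝ)
    (hμ : IsProbDist μ) (hν : IsProbDist ν) :
    ∃ δ : Flow n m, applyFlow μ δ = ν := by
  set F := extend (fun x => μ x - ν x) with hF
  -- Push the excess of each row into the last column, then balance the last column.
  set P : ℕ → ℕ → ℝ := fun i j => ∑ k ∈ Finset.range j, F i k with hP
  set C : ℕ → ℕ → ℝ :=
    fun i j => if j + 1 = m then ∑ l ∈ Finset.range i, P l m else 0 with hC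
  have hsum : ∑ l ∈ Finset.range n, P l m = 0 := by
    simp only [hP, hF, sum_extend, Finset.sum_sub_distrib, hμ.2, hν.2, sub_self]
  refine ⟨(fun i j => P i (j + 1), fun i j => C (i + 1) j), ?_⟩
  funext ⟨⟨i, hi⟩, ⟨j, hj⟩⟩
  have hval : F i j = μ (⟨i, hi⟩, ⟨j, hj⟩) - ν (⟨i, hi⟩, ⟨j, hj⟩) := by
    simp [hF, extend, hi, hj]
  have hPs : P i (j + 1) = P i j + F i j := Finset.sum_range_succ _ _
  have hCs : C (i + 1) j = C i j + if j + 1 = m then P i m else 0 := by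
    simp only [hC]
    split_ifs
    · exact Finset.sum_range_succ _ _
    · simp
  have hdown : (if i < n - 1 ∧ j < m then C (i + 1) j else 0) = C (i + 1) j := by
    by_cases h : i < n - 1
    · simp [h, hj]
    · have hn : i + 1 = n := by omega
      simp [hC, hn, hsum]
  simp only [applyFlow]
  rw [entry_sub_one_left C i j (by omega) hj (by simp [hC]),
    entry_sub_one_right P i j (by omega) hi (by simp [hP]),
    entry_natCast (fun i j => C (i + 1) j), entry_natCast (fun i j => P i (j + 1)), hdown, hCs]
  by_cases h : j + 1 = m
  · have hlast : ¬ j < m - 1 := by omega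
    rw [h] at hPs
    simp only [h, hlast, and_false, if_true, if_false]
    linarith
  · have hlt : j < m - 1 := by omega
    simp only [h, hi, hlt, and_self, if_true, if_false]
    linarith

end WassersteinFlow
end

section
/- For any two probability distributions μ and ν on the n×m pixel grid, the 1-Wasserstein distance with L1 ground metric satisfies W₁(μ, ν) = min { ‖δ‖₁ : δ a flow with ν = Δ(μ, δ) }, where ‖δ‖₁ is the sum of the absolute values of all entries of δ→ and δ↓; in particular this minimum is attained. -/
namespace WassersteinFlow

section Plans

variable {X : Type*} [Fintype X] [DecidableEq X]

/-- Mass entering and leaving a point `x` along routes through `x` can be rerouted directly, when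
no mass of the plan rests at `x`. -/
theorem exists_plan_reroute_of_diag_eq_zero (d : X → X → ℝ)
    (htri : ∀ x y z, d x z ≤ d x y + d y z) (π : X → X → ℝ) (hπ : ∀ x y, 0 ≤ π x y)
    (x : X) (hx : π x x = 0) (c : ℝ) (hc : 0 < c) (hr : c ≤ ∑ y, π x y)
    (hs : c ≤ ∑ y, π y x) :
    ∃ π' : X → X → ℝ, (∀ y z, 0 ≤ π' y z) ∧
      (∀ y, ∑ z, π' y z = ∑ z, π y z - if y = x then c else 0) ∧
      (∀ z, ∑ y, π' y z = ∑ y, π y z - if z = x then c else 0) ∧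
      ∑ y, ∑ z, d y z * π' y z ≤ ∑ y, ∑ z, d y z * π y z := by
  set R := ∑ y, π x y with hR
  set C := ∑ y, π y x with hC
  clear_value R C
  have hR0 : 0 < R := hc.trans_le hr
  have hC0 : 0 < C := hc.trans_le hs
  have hcR : c / R ≤ 1 := (div_le_one hR0).2 hr
  have hcC : c / C ≤ 1 := (div_le_one hC0).2 hs
  refine ⟨fun y z => π y z - (if y = x then c / R * π x z else 0)
    - (if z = x then c / C * π y x else 0) + c / (R * C) * (π y x * π x z), ?_, ?_, ?_, ?_⟩
  · intro y z
    have h3 : 0 ≤ c / (R * C) * (π y x * π x z) :=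
      mul_nonneg (by positivity) (mul_nonneg (hπ _ _) (hπ _ _))
    by_cases hy : y = x <;> by_cases hz : z = x
    · subst hy; subst hz; simp [hx]
    · subst hy
      simp only [if_true, if_neg hz]
      nlinarith [hπ y z]
    · subst hz
      simp only [if_true, if_neg hy]
      nlinarith [hπ y z]
    · simp only [if_neg hy, if_neg hz]
      linarith [hπ y z]
  · intro y
    simp only [Finset.sum_add_distrib, Finset.sum_sub_distrib, Finset.sum_ite_eq',
      Finset.mem_univ, if_true, ← Finset.mul_sum, ← hR]
    by_cases hy : y = x
    · simp only [hy, if_true, ← Finset.mul_sum, ← hR, hx]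
      field_simp
      ring
    · simp only [hy, if_false, Finset.sum_const_zero]
      field_simp
      ring
  · intro z
    simp only [Finset.sum_add_distrib, Finset.sum_sub_distrib, Finset.sum_ite_eq',
      Finset.mem_univ, if_true, ← Finset.mul_sum, ← Finset.sum_mul, ← hC]
    by_cases hz : z = x
    · simp only [hz, if_true, ← Finset.mul_sum, ← hC, hx]
      field_simp
      ring
    · simp only [hz, if_false, Finset.sum_const_zero]
      field_simp
      ring
  · have h1 : ∑ y, ∑ z, d y z * (if y = x then c / R * π x z else 0)
        = c / R * ∑ z, d x z * π x z := by
      rw [Finset.sum_eq_single x (fun y _ hy => by simp [hy]) (by simp), Finset.mul_sum]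
      exact Finset.sum_congr rfl fun z _ => by simp only [if_true]; ring
    have h2 : ∑ y, ∑ z, d y z * (if z = x then c / C * π y x else 0)
        = c / C * ∑ y, d y x * π y x := by
      rw [Finset.mul_sum]
      refine Finset.sum_congr rfl fun y _ => ?_
      rw [Finset.sum_eq_single x (fun z _ hz => by simp [hz]) (by simp)]
      simp only [if_true]; ring
    have h3 : ∑ y, ∑ z, d y z * (c / (R * C) * (π y x * π x z))
        ≤ c / R * ∑ z, d x z * π x z + c / C * ∑ y, d y x * π y x := by
      calc ∑ y, ∑ z, d y z * (c / (R * C) * (π y x * π x z))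
          ≤ ∑ y, ∑ z, (d y x + d x z) * (c / (R * C) * (π y x * π x z)) := by
            refine Finset.sum_le_sum fun y _ => Finset.sum_le_sum fun z _ =>
              mul_le_mul_of_nonneg_right (htri _ _ _) ?_
            exact mul_nonneg (by positivity) (mul_nonneg (hπ _ _) (hπ _ _))
        _ = c / (R * C) * ((∑ y, d y x * π y x) * R + C * ∑ z, d x z * π x z) := by
            have e1 : (∑ y, d y x * π y x) * R = ∑ y, ∑ z, d y x * π y x * π x z := by
              rw [hR, Finset.sum_mul_sum]
            have e2 : C * ∑ z, d x z * π x z = ∑ y, ∑ z, π y x * (d x z * π x z) := by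
              rw [hC, Finset.sum_mul_sum]
            rw [e1, e2, ← Finset.sum_add_distrib, Finset.mul_sum]
            refine Finset.sum_congr rfl fun y _ => ?_
            rw [← Finset.sum_add_distrib, Finset.mul_sum]
            exact Finset.sum_congr rfl fun z _ => by ring
        _ = _ := by field_simp; ring
    simp only [mul_add, mul_sub, Finset.sum_add_distrib, Finset.sum_sub_distrib]
    linarith

/-- The row and column sums of a plan at a point `x` can be lowered by the same amount without
increasing the cost. -/
theorem exists_plan_reroute (d : X → X → ℝ) (hd : ∀ x, d x x = 0)
    (htri : ∀ x y z, d x z ≤ d x y + d y z) (π : X → X → ℝ) (hπ : ∀ x y, 0 ≤ π x y)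
    (x : X) (c : ℝ) (hr : c ≤ ∑ y, π x y) (hs : c ≤ ∑ y, π y x) :
    ∃ π' : X → X → ℝ, (∀ y z, 0 ≤ π' y z) ∧
      (∀ y, ∑ z, π' y z = ∑ z, π y z - if y = x then c else 0) ∧
      (∀ z, ∑ y, π' y z = ∑ y, π y z - if z = x then c else 0) ∧
      ∑ y, ∑ z, d y z * π' y z ≤ ∑ y, ∑ z, d y z * π y z := by
  have key : ∀ b ≤ π x x, ∃ π' : X → X → ℝ, (∀ y z, 0 ≤ π' y z) ∧ π' x x = π x x - b ∧
      (∀ y, ∑ z, π' y z = ∑ z, π y z - if y = x then b else 0) ∧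
      (∀ z, ∑ y, π' y z = ∑ y, π y z - if z = x then b else 0) ∧
      ∑ y, ∑ z, d y z * π' y z ≤ ∑ y, ∑ z, d y z * π y z := by
    intro b hb
    refine ⟨fun y z => π y z - if y = x then if z = x then b else 0 else 0, ?_, by simp, ?_, ?_, ?_⟩
    · intro y z
      by_cases hy : y = x <;> by_cases hz : z = x <;> simp [hy, hz, hπ, hb]
    · intro y
      by_cases hy : y = x <;> simp [hy]
    · intro z
      simp
    · refine Finset.sum_le_sum fun y _ => Finset.sum_le_sum fun z _ => le_of_eq ?_
      by_cases hy : y = x <;> by_cases hz : z = x <;> simp [hy, hz, hd]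
  rcases le_or_gt c (π x x) with h | h
  · obtain ⟨π', h1, -, h2, h3, h4⟩ := key c h
    exact ⟨π', h1, h2, h3, h4⟩
  · obtain ⟨ρ, h1, h0, h2, h3, h4⟩ := key (π x x) le_rfl
    obtain ⟨π', k1, k2, k3, k4⟩ := exists_plan_reroute_of_diag_eq_zero d htri ρ h1 x
      (by rw [h0, sub_self]) (c - π x x) (by linarith)
      (by rw [h2]; simpa using hr) (by rw [h3]; simpa using hs)
    refine ⟨π', k1, fun y => ?_, fun z => ?_, k4.trans h4⟩
    · rw [k2, h2]; split_ifs <;> ring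
    · rw [k3, h3]; split_ifs <;> ring

/-- A plan whose net transport is `ν - μ` can be replaced by a plan with marginals `μ` and `ν`
without increasing the cost. -/
theorem exists_plan_of_net (d : X → X → ℝ) (hd : ∀ x, d x x = 0)
    (htri : ∀ x y z, d x z ≤ d x y + d y z) (π : X → X → ℝ) (hπ : ∀ x y, 0 ≤ π x y)
    (μ ν : X → ℝ) (hμ : ∀ x, 0 ≤ μ x) (hν : ∀ x, 0 ≤ ν x)
    (hnet : ∀ x, ∑ y, π y x - ∑ y, π x y = ν x - μ x) :
    ∃ π' : X → X → ℝ, (∀ y z, 0 ≤ π' y z) ∧ (∀ y, ∑ z, π' y z = μ y) ∧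
      (∀ z, ∑ y, π' y z = ν z) ∧
      ∑ y, ∑ z, d y z * π' y z ≤ ∑ y, ∑ z, d y z * π y z := by
  have key : ∀ S : Finset X, ∃ π' : X → X → ℝ, (∀ y z, 0 ≤ π' y z) ∧
      (∀ y, ∑ z, π' y z = if y ∈ S then μ y else ∑ z, π y z) ∧
      (∀ z, ∑ y, π' y z = if z ∈ S then ν z else ∑ y, π y z) ∧
      ∑ y, ∑ z, d y z * π' y z ≤ ∑ y, ∑ z, d y z * π y z := by
    intro S
    induction S using Finset.induction_on with
    | empty => exact ⟨π, hπ, by simp, by simp, le_rfl⟩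
    | insert x S hx ih =>
      obtain ⟨ρ, h1, h2, h3, h4⟩ := ih
      have hxr := h2 x
      have hxs := h3 x
      rw [if_neg hx] at hxr hxs
      obtain ⟨π', k1, k2, k3, k4⟩ := exists_plan_reroute d hd htri ρ h1 x (∑ z, π x z - μ x)
        (by linarith [hμ x]) (by linarith [hν x, hnet x])
      refine ⟨π', k1, fun y => ?_, fun z => ?_, k4.trans h4⟩
      · by_cases hy : y = x
        · subst hy; rw [k2, hxr]; simp
        · rw [k2, h2]; simp [hy]
      · by_cases hz : z = x
        · subst hz; rw [k3, hxs]; simp; linarith [hnet z]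
        · rw [k3, h3]; simp [hz]
  simpa using key Finset.univ

end Plans

section Edges

variable {X E : Type*} [DecidableEq X] [Fintype E]

/-- The net inflow at `x` of an edge flow `δ` on the directed graph with edges `s e → t e`. -/
def netInflow (s t : E → X) (δ : E → ℝ) (x : X) : ℝ :=
  ∑ e, δ e * ((if t e = x then 1 else 0) - if s e = x then 1 else 0)

/-- An edge flow along edges of length at most one gives a plan of no larger cost. -/
theorem exists_plan_of_netInflow [Fintype X] (d : X → X → ℝ) (hd : ∀ x, d x x = 0)
    (htri : ∀ x y z, d x z ≤ d x y + d y z) (s t : E → X) (hst : ∀ e, d (s e) (t e) ≤ 1)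
    (hts : ∀ e, d (t e) (s e) ≤ 1) (δ : E → ℝ) (μ ν : X → ℝ) (hμ : ∀ x, 0 ≤ μ x)
    (hν : ∀ x, 0 ≤ ν x) (hnet : ∀ x, netInflow s t δ x = ν x - μ x) :
    ∃ π : X → X → ℝ, (∀ y z, 0 ≤ π y z) ∧ (∀ y, ∑ z, π y z = μ y) ∧
      (∀ z, ∑ y, π y z = ν z) ∧ ∑ y, ∑ z, d y z * π y z ≤ ∑ e, |δ e| := by
  let ρ : X → X → ℝ := fun y z => ∑ e, ((if s e = y then if t e = z then (δ e)⁺ else 0 else 0)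
    + if t e = y then if s e = z then (δ e)⁻ else 0 else 0)
  have hρ : ∀ y z, 0 ≤ ρ y z := fun y z => Finset.sum_nonneg fun e _ => by
    have := posPart_nonneg (δ e)
    have := negPart_nonneg (δ e)
    split_ifs <;> linarith
  have hrow : ∀ y, ∑ z, ρ y z =
      ∑ e, ((if s e = y then (δ e)⁺ else 0) + if t e = y then (δ e)⁻ else 0) := by
    intro y
    rw [Finset.sum_comm]
    refine Finset.sum_congr rfl fun e _ => ?_
    rw [Finset.sum_add_distrib]
    split_ifs <;> simp
  have hcol : ∀ z, ∑ y, ρ y z =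
      ∑ e, ((if t e = z then (δ e)⁺ else 0) + if s e = z then (δ e)⁻ else 0) := by
    intro z
    rw [Finset.sum_comm]
    refine Finset.sum_congr rfl fun e _ => ?_
    rw [Finset.sum_add_distrib]
    simp
  obtain ⟨π, h1, h2, h3, h4⟩ := exists_plan_of_net d hd htri ρ hρ μ ν hμ hν (by
    intro x
    rw [hrow, hcol, ← hnet, netInflow, ← Finset.sum_sub_distrib]
    refine Finset.sum_congr rfl fun e _ => ?_
    have := posPart_sub_negPart (δ e)
    split_ifs <;> linarith)
  refine ⟨π, h1, h2, h3, h4.trans ?_⟩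
  have hcost : ∑ y, ∑ z, d y z * ρ y z
      = ∑ e, (d (s e) (t e) * (δ e)⁺ + d (t e) (s e) * (δ e)⁻) := by
    simp only [ρ, Finset.mul_sum]
    rw [Finset.sum_congr rfl fun y _ => Finset.sum_comm, Finset.sum_comm]
    refine Finset.sum_congr rfl fun e _ => ?_
    simp only [mul_add, Finset.sum_add_distrib, mul_ite, mul_zero]
    congr 1
    · rw [Finset.sum_eq_single (s e) (fun y _ hy => by simp [hy.symm]) (by simp)]
      simp
    · rw [Finset.sum_eq_single (t e) (fun y _ hy => by simp [hy.symm]) (by simp)]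
      simp
  rw [hcost]
  refine Finset.sum_le_sum fun e _ => ?_
  rw [← posPart_add_negPart (δ e)]
  have := mul_le_mul_of_nonneg_right (hst e) (posPart_nonneg (δ e))
  have := mul_le_mul_of_nonneg_right (hts e) (negPart_nonneg (δ e))
  linarith

/-- There is a flow transporting unit mass from `x` to `y` with norm at most `k`. -/
def HasUnitFlow (s t : E → X) (x y : X) (k : ℝ) : Prop :=
  ∃ δ : E → ℝ, (∀ z, netInflow s t δ z = (if y = z then 1 else 0) - if x = z then 1 else 0) ∧
    ∑ e, |δ e| ≤ k

theorem HasUnitFlow.refl (s t : E → X) (x : X) : HasUnitFlow s t x x 0 :=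
  ⟨0, by simp [netInflow], by simp⟩

theorem HasUnitFlow.symm {s t : E → X} {x y : X} {k : ℝ} (h : HasUnitFlow s t x y k) :
    HasUnitFlow s t y x k := by
  obtain ⟨δ, h1, h2⟩ := h
  refine ⟨-δ, fun z => ?_, by simpa using h2⟩
  have : netInflow s t (-δ) z = - netInflow s t δ z := by
    simp [netInflow]
  rw [this, h1]; ring

theorem HasUnitFlow.trans {s t : E → X} {x y z : X} {k l : ℝ} (h : HasUnitFlow s t x y k)
    (h' : HasUnitFlow s t y z l) : HasUnitFlow s t x z (k + l) := by
  obtain ⟨δ, h1, h2⟩ := h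
  obtain ⟨δ', h1', h2'⟩ := h'
  refine ⟨δ + δ', fun w => ?_, ?_⟩
  · have : netInflow s t (δ + δ') w = netInflow s t δ w + netInflow s t δ' w := by
      simp [netInflow, add_mul, Finset.sum_add_distrib]
    rw [this, h1, h1']; ring
  · refine le_trans ?_ (add_le_add h2 h2')
    rw [← Finset.sum_add_distrib]
    exact Finset.sum_le_sum fun e _ => abs_add_le _ _

theorem HasUnitFlow.edge (s t : E → X) (e : E) : HasUnitFlow s t (s e) (t e) 1 := by
  classical
  refine ⟨Pi.single e 1, fun z => ?_, ?_⟩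
  · rw [netInflow, Finset.sum_eq_single e (fun b _ hb => by simp [hb]) (by simp)]
    simp
  · rw [Finset.sum_eq_single e (fun b _ hb => by simp [hb]) (by simp)]
    simp

/-- Unit flows along the pairs of a plan combine to a flow with no larger norm than the cost. -/
theorem exists_netInflow_of_plan [Fintype X] (d : X → X → ℝ) (s t : E → X)
    (h : ∀ x y, HasUnitFlow s t x y (d x y)) (π : X → X → ℝ) (hπ : ∀ x y, 0 ≤ π x y) :
    ∃ δ : E → ℝ, (∀ x, netInflow s t δ x = ∑ y, π y x - ∑ y, π x y) ∧
      ∑ e, |δ e| ≤ ∑ x, ∑ y, d x y * π x y := by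
  choose f hf1 hf2 using h
  refine ⟨fun e => ∑ x, ∑ y, π x y * f x y e, fun z => ?_, ?_⟩
  · have : netInflow s t (fun e => ∑ x, ∑ y, π x y * f x y e) z
        = ∑ x, ∑ y, π x y * netInflow s t (f x y) z := by
      simp only [netInflow, Finset.sum_mul, Finset.mul_sum]
      rw [Finset.sum_comm]
      refine Finset.sum_congr rfl fun x _ => ?_
      rw [Finset.sum_comm]
      exact Finset.sum_congr rfl fun y _ => Finset.sum_congr rfl fun e _ => by ring
    rw [this]
    simp only [hf1, mul_sub, Finset.sum_sub_distrib]
    congr 1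
    · simp
    · rw [Finset.sum_eq_single z (fun x _ hx => by simp [hx]) (by simp)]
      simp
  · calc ∑ e, |∑ x, ∑ y, π x y * f x y e|
        ≤ ∑ e, ∑ x, ∑ y, π x y * |f x y e| := by
          refine Finset.sum_le_sum fun e _ => (Finset.abs_sum_le_sum_abs _ _).trans
            (Finset.sum_le_sum fun x _ => (Finset.abs_sum_le_sum_abs _ _).trans
              (Finset.sum_le_sum fun y _ => ?_))
          rw [abs_mul, abs_of_nonneg (hπ x y)]
      _ = ∑ x, ∑ y, π x y * ∑ e, |f x y e| := by
          rw [Finset.sum_comm]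
          refine Finset.sum_congr rfl fun x _ => ?_
          rw [Finset.sum_comm]
          exact Finset.sum_congr rfl fun y _ => (Finset.mul_sum _ _ _).symm
      _ ≤ ∑ x, ∑ y, d x y * π x y := by
          refine Finset.sum_le_sum fun x _ => Finset.sum_le_sum fun y _ => ?_
          rw [mul_comm (d x y)]
          exact mul_le_mul_of_nonneg_left (hf2 x y) (hπ x y)

end Edges

section Grid

variable {n m : ℕ}

/-- The starting point of a grid edge. -/
def edgeSource : FlowIdx n m → Fin n × Fin m :=
  Sum.elim (fun p => (p.1, ⟨p.2, by omega⟩)) (fun p => (⟨p.1, by omega⟩, p.2))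

/-- The end point of a grid edge. -/
def edgeTarget : FlowIdx n m → Fin n × Fin m :=
  Sum.elim (fun p => (p.1, ⟨p.2 + 1, by omega⟩)) (fun p => (⟨p.1 + 1, by omega⟩, p.2))

theorem flowL1_eq_sum_flat (δ : Flow n m) : flowL1 δ = ∑ e, |flat δ e| := by
  simp [flowL1, flat, Fintype.sum_sum_type, Fintype.sum_prod_type]

theorem entry_eq_sum {a b : ℕ} (δ : Fin a → Fin b → ℝ) (i j : ℤ) :
    entry δ i j = ∑ p : Fin a × Fin b, δ p.1 p.2 * if (p.1 : ℤ) = i ∧ (p.2 : ℤ) = j then 1 else 0 := by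
  unfold entry
  split_ifs with h
  · rw [Finset.sum_eq_single (⟨i.toNat, by omega⟩, ⟨j.toNat, by omega⟩)]
    · rw [if_pos (by constructor <;> simp <;> omega), mul_one]
    · rintro ⟨p, q⟩ - hpq
      rw [if_neg, mul_zero]
      rintro ⟨h1, h2⟩
      apply hpq
      ext <;> simp at h1 h2 ⊢ <;> omega
    · simp
  · symm
    refine Finset.sum_eq_zero fun p _ => ?_
    rw [if_neg, mul_zero]
    omega

theorem applyFlow_eq_add_netInflow (μ : Fin n × Fin m → ℝ) (δ : Flow n m) (x : Fin n × Fin m) :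
    applyFlow μ δ x = μ x + netInflow edgeSource edgeTarget (flat δ) x := by
  have h1 : entry δ.2 ((x.1 : ℤ) - 1) (x.2 : ℤ) = ∑ p : Fin (n - 1) × Fin m,
      flat δ (.inr p) * if edgeTarget (n := n) (m := m) (.inr p) = x then 1 else 0 := by
    rw [entry_eq_sum]
    refine Finset.sum_congr rfl fun p _ => ?_
    congr 2
    simp only [edgeTarget, Sum.elim_inr, Prod.ext_iff, Fin.ext_iff, eq_iff_iff]
    omega
  have h2 : entry δ.1 (x.1 : ℤ) ((x.2 : ℤ) - 1) = ∑ p : Fin n × Fin (m - 1),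
      flat δ (.inl p) * if edgeTarget (n := n) (m := m) (.inl p) = x then 1 else 0 := by
    rw [entry_eq_sum]
    refine Finset.sum_congr rfl fun p _ => ?_
    congr 2
    simp only [edgeTarget, Sum.elim_inl, Prod.ext_iff, Fin.ext_iff, eq_iff_iff]
    omega
  have h3 : entry δ.2 (x.1 : ℤ) (x.2 : ℤ) = ∑ p : Fin (n - 1) × Fin m,
      flat δ (.inr p) * if edgeSource (n := n) (m := m) (.inr p) = x then 1 else 0 := by
    rw [entry_eq_sum]
    refine Finset.sum_congr rfl fun p _ => ?_
    congr 2
    simp only [edgeSource, Sum.elim_inr, Prod.ext_iff, Fin.ext_iff, eq_iff_iff]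
    omega
  have h4 : entry δ.1 (x.1 : ℤ) (x.2 : ℤ) = ∑ p : Fin n × Fin (m - 1),
      flat δ (.inl p) * if edgeSource (n := n) (m := m) (.inl p) = x then 1 else 0 := by
    rw [entry_eq_sum]
    refine Finset.sum_congr rfl fun p _ => ?_
    congr 2
    simp only [edgeSource, Sum.elim_inl, Prod.ext_iff, Fin.ext_iff, eq_iff_iff]
    omega
  simp only [applyFlow, h1, h2, h3, h4, netInflow, Fintype.sum_sum_type, mul_sub,
    Finset.sum_sub_distrib]
  ring

theorem applyFlow_eq_iff (μ ν : Fin n × Fin m → ℝ) (δ : Flow n m) :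
    applyFlow μ δ = ν ↔ ∀ x, netInflow edgeSource edgeTarget (flat δ) x = ν x - μ x := by
  rw [funext_iff]
  refine forall_congr' fun x => ?_
  rw [applyFlow_eq_add_netInflow, eq_sub_iff_add_eq']

theorem gd_self (x : Fin n × Fin m) : gd x x = 0 := by
  simp [gd]

theorem gd_triangle (x y z : Fin n × Fin m) : gd x z ≤ gd x y + gd y z := by
  unfold gd
  rw [← Int.cast_add, Int.cast_le]
  have := abs_sub_le (x.1 : ℤ) y.1 z.1
  have := abs_sub_le (x.2 : ℤ) y.2 z.2
  linarith

theorem gd_edgeSource_edgeTarget (e : FlowIdx n m) : gd (edgeSource e) (edgeTarget e) ≤ 1 := by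
  rcases e with e | e <;> simp [gd, edgeSource, edgeTarget]

theorem gd_edgeTarget_edgeSource (e : FlowIdx n m) : gd (edgeTarget e) (edgeSource e) ≤ 1 := by
  rcases e with e | e <;> simp [gd, edgeSource, edgeTarget]

theorem hasUnitFlow_row (i : Fin n) (j k : Fin m) :
    HasUnitFlow edgeSource edgeTarget (i, j) (i, k) ((|(j : ℤ) - k| : ℤ) : ℝ) := by
  have key : ∀ l : ℕ, ∀ j k : Fin m, (k : ℕ) = j + l →
      HasUnitFlow edgeSource edgeTarget (i, j) (i, k) (l : ℝ) := by
    intro l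
    induction l with
    | zero =>
      intro j k h
      obtain rfl : k = j := Fin.ext h
      simpa using HasUnitFlow.refl _ _ _
    | succ l ih =>
      intro j k h
      have h1 := ih j ⟨j + l, by omega⟩ rfl
      have h2 := HasUnitFlow.edge (edgeSource (n := n) (m := m)) edgeTarget
        (.inl (i, ⟨j + l, by omega⟩))
      have hk : k = ⟨j + l + 1, by omega⟩ := Fin.ext h
      rw [hk]
      push_cast
      exact h1.trans h2
  rcases le_total j k with h | h
  · have h' : (j : ℕ) ≤ k := h
    have := key (k - j) j k (by omega)
    rwa [Nat.cast_sub h', ← Int.cast_natCast (k : ℕ), ← Int.cast_natCast (j : ℕ), ← Int.cast_sub,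
      ← abs_of_nonneg (show (0 : ℤ) ≤ (k : ℕ) - (j : ℕ) by omega), abs_sub_comm] at this
  · have h' : (k : ℕ) ≤ j := h
    have := (key (j - k) k j (by omega)).symm
    rwa [Nat.cast_sub h', ← Int.cast_natCast (k : ℕ), ← Int.cast_natCast (j : ℕ), ← Int.cast_sub,
      ← abs_of_nonneg (show (0 : ℤ) ≤ (j : ℕ) - (k : ℕ) by omega)] at this

theorem hasUnitFlow_column (j : Fin m) (i k : Fin n) :
    HasUnitFlow edgeSource edgeTarget (i, j) (k, j) ((|(i : ℤ) - k| : ℤ) : ℝ) := by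
  have key : ∀ l : ℕ, ∀ i k : Fin n, (k : ℕ) = i + l →
      HasUnitFlow edgeSource edgeTarget (i, j) (k, j) (l : ℝ) := by
    intro l
    induction l with
    | zero =>
      intro i k h
      obtain rfl : k = i := Fin.ext h
      simpa using HasUnitFlow.refl _ _ _
    | succ l ih =>
      intro i k h
      have h1 := ih i ⟨i + l, by omega⟩ rfl
      have h2 := HasUnitFlow.edge (edgeSource (n := n) (m := m)) edgeTarget
        (.inr (⟨i + l, by omega⟩, j))
      have hk : k = ⟨i + l + 1, by omega⟩ := Fin.ext h
      rw [hk]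
      push_cast
      exact h1.trans h2
  rcases le_total i k with h | h
  · have h' : (i : ℕ) ≤ k := h
    have := key (k - i) i k (by omega)
    rwa [Nat.cast_sub h', ← Int.cast_natCast (k : ℕ), ← Int.cast_natCast (i : ℕ), ← Int.cast_sub,
      ← abs_of_nonneg (show (0 : ℤ) ≤ (k : ℕ) - (i : ℕ) by omega), abs_sub_comm] at this
  · have h' : (k : ℕ) ≤ i := h
    have := (key (i - k) k i (by omega)).symm
    rwa [Nat.cast_sub h', ← Int.cast_natCast (k : ℕ), ← Int.cast_natCast (i : ℕ), ← Int.cast_sub,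
      ← abs_of_nonneg (show (0 : ℤ) ≤ (i : ℕ) - (k : ℕ) by omega)] at this

theorem hasUnitFlow_gd (x y : Fin n × Fin m) :
    HasUnitFlow edgeSource edgeTarget x y (gd x y) := by
  have := (hasUnitFlow_column x.2 x.1 y.1).trans (hasUnitFlow_row y.1 x.2 y.2)
  rwa [← Int.cast_add] at this

/-- Every flow from `μ` to `ν` dominates the cost of some coupling. -/
theorem exists_coupling_cost_le_flowL1 {μ ν : Fin n × Fin m → ℝ} (hμ : ∀ x, 0 ≤ μ x)
    (hν : ∀ x, 0 ≤ ν x) (δ : Flow n m) (hδ : applyFlow μ δ = ν) :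
    ∃ π, IsCoupling μ ν π ∧
      ∑ p : (Fin n × Fin m) × (Fin n × Fin m), gd p.1 p.2 * π p ≤ flowL1 δ := by
  obtain ⟨π, h1, h2, h3, h4⟩ := exists_plan_of_netInflow gd gd_self gd_triangle edgeSource
    edgeTarget gd_edgeSource_edgeTarget gd_edgeTarget_edgeSource (flat δ) μ ν hμ hν
    ((applyFlow_eq_iff μ ν δ).1 hδ)
  refine ⟨fun p => π p.1 p.2, ⟨fun p => h1 _ _, h2, h3⟩, ?_⟩
  rw [Fintype.sum_prod_type, flowL1_eq_sum_flat]
  exact h4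

/-- Every coupling of `μ` and `ν` has cost at least the norm of some flow from `μ` to `ν`. -/
theorem exists_flowL1_le_coupling_cost {μ ν : Fin n × Fin m → ℝ}
    {π : (Fin n × Fin m) × (Fin n × Fin m) → ℝ} (hπ : IsCoupling μ ν π) :
    ∃ δ : Flow n m, applyFlow μ δ = ν ∧
      flowL1 δ ≤ ∑ p : (Fin n × Fin m) × (Fin n × Fin m), gd p.1 p.2 * π p := by
  obtain ⟨δ, h1, h2⟩ := exists_netInflow_of_plan gd edgeSource edgeTarget hasUnitFlow_gd
    (fun x y => π (x, y)) (fun x y => hπ.1 _)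
  have hflat : flat (n := n) (m := m)
      (fun i j => δ (.inl (i, j)), fun i j => δ (.inr (i, j))) = δ := by
    funext e
    rcases e with e | e <;> rfl
  refine ⟨(fun i j => δ (.inl (i, j)), fun i j => δ (.inr (i, j))), ?_, ?_⟩
  · rw [applyFlow_eq_iff, hflat]
    intro x
    rw [h1, hπ.2.1, hπ.2.2]
  · rw [flowL1_eq_sum_flat, hflat, Fintype.sum_prod_type]
    exact h2

theorem isCompact_setOf_isCoupling {μ ν : Fin n × Fin m → ℝ} :
    IsCompact {π | IsCoupling μ ν π} := by
  refine IsCompact.of_isClosed_subset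
    (isCompact_Icc (a := 0) (b := fun p : (Fin n × Fin m) × (Fin n × Fin m) => μ p.1)) ?_ ?_
  · simp only [IsCoupling, Set.ofPred_and]
    refine IsClosed.inter ?_ (IsClosed.inter ?_ ?_)
    · simp only [Set.ofPred_forall]
      exact isClosed_iInter fun p => isClosed_le (by fun_prop) (by fun_prop)
    · simp only [Set.ofPred_forall]
      exact isClosed_iInter fun p => isClosed_eq (by fun_prop) (by fun_prop)
    · simp only [Set.ofPred_forall]
      exact isClosed_iInter fun p => isClosed_eq (by fun_prop) (by fun_prop)
  · intro π hπ
    refine ⟨hπ.1, fun p => ?_⟩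
    change π p ≤ μ p.1
    rw [← hπ.2.1 p.1]
    exact Finset.single_le_sum (f := fun y => π (p.1, y)) (fun y _ => hπ.1 _)
      (Finset.mem_univ p.2)

theorem isCoupling_mul {μ ν : Fin n × Fin m → ℝ} (hμ : IsProbDist μ) (hν : IsProbDist ν) :
    IsCoupling μ ν fun p => μ p.1 * ν p.2 :=
  ⟨fun p => mul_nonneg (hμ.1 _) (hν.1 _), fun x => by simp [← Finset.mul_sum, hν.2],
    fun y => by simp [← Finset.sum_mul, hμ.2]⟩

/-- The infimum defining `W1` is attained. -/
theorem exists_isLeast_W1 {μ ν : Fin n × Fin m → ℝ} (hμ : IsProbDist μ) (hν : IsProbDist ν) :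
    ∃ π, IsCoupling μ ν π ∧
      W1 μ ν = ∑ p : (Fin n × Fin m) × (Fin n × Fin m), gd p.1 p.2 * π p ∧
      ∀ π', IsCoupling μ ν π' →
        W1 μ ν ≤ ∑ p : (Fin n × Fin m) × (Fin n × Fin m), gd p.1 p.2 * π' p := by
  obtain ⟨π, hπ, hmin⟩ := isCompact_setOf_isCoupling.exists_isMinOn ⟨_, isCoupling_mul hμ hν⟩
    (f := fun π => ∑ p : (Fin n × Fin m) × (Fin n × Fin m), gd p.1 p.2 * π p)
    (Continuous.continuousOn (by fun_prop))
  have hleast : IsLeast {c | ∃ π, IsCoupling μ ν π ∧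
      c = ∑ p : (Fin n × Fin m) × (Fin n × Fin m), gd p.1 p.2 * π p}
      (∑ p : (Fin n × Fin m) × (Fin n × Fin m), gd p.1 p.2 * π p) := by
    refine ⟨⟨π, hπ, rfl⟩, ?_⟩
    rintro _ ⟨π', hπ', rfl⟩
    exact hmin hπ'
  have hW : W1 μ ν = ∑ p : (Fin n × Fin m) × (Fin n × Fin m), gd p.1 p.2 * π p :=
    hleast.csInf_eq
  exact ⟨π, hπ, hW, fun π' hπ' => hW ▸ hmin hπ'⟩

end Grid

/-- `W₁(μ, ν) = min { ‖δ‖₁ : ν = Δ(μ, δ) }`, the minimum being attained. -/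
theorem W1_eq_min_flowL1 (n m : ℕ) (μ ν : Fin n × Fin m → ℝ)
    (hμ : IsProbDist μ) (hν : IsProbDist ν) :
    ∃ δ : Flow n m, applyFlow μ δ = ν ∧ flowL1 δ = W1 μ ν ∧
      ∀ δ' : Flow n m, applyFlow μ δ' = ν → flowL1 δ ≤ flowL1 δ' := by
  obtain ⟨π, hπ, hW, hmin⟩ := exists_isLeast_W1 hμ hν
  obtain ⟨δ, hδ, hle⟩ := exists_flowL1_le_coupling_cost hπ
  have hlower : ∀ δ' : Flow n m, applyFlow μ δ' = ν → W1 μ ν ≤ flowL1 δ' := by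
    intro δ' hδ'
    obtain ⟨π', hπ', hle'⟩ := exists_coupling_cost_le_flowL1 hμ.1 hν.1 δ' hδ'
    exact (hmin π' hπ').trans hle'
  have heq : flowL1 δ = W1 μ ν := le_antisymm (hW ▸ hle) (hlower δ hδ)
  exact ⟨δ, hδ, heq, fun δ' hδ' => heq.trans_le (hlower δ' hδ')⟩

end WassersteinFlow
end

section
/- (L1 perturbation solution for linear classifiers.) Let F(x) = argmax_t (Wx + b)_t be a linear classifier with W ∈ ℝ^{C×nm}, b ∈ ℝ^C, let μ be a probability distribution on the n×m pixel grid classified as y = F(μ), let R be a reference probability distribution, A the matrix with Δ(R,δ) = R + Aδ, and δ^μ a flow with Δ(R, δ^μ) = μ. For each class t ≠ y set w_t := (WA)_y − (WA)_t ∈ ℝ^{n(m−1)+(n−1)m} and d_t := (WR + b)_y − (WR + b)_t ∈ ℝ, and assume w_t ≠ 0 for all t ≠ y. Define ε := min_{t ≠ y} min_j |(−d_t − w_tᵀδ^μ)| / |(w_t)_j| taken over indices j maximizing |(w_t)_j| (equivalently, ε = min_{t≠y} |w_tᵀδ^μ + d_t| / ‖w_t‖_∞). Then every probability distribution ν with W₁(μ,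 ν) < ε satisfies F(ν) = y. -/
namespace WassersteinFlow

/-- A function on `Fin n` whose consecutive increments are at most `K` is `K`-Lipschitz. -/
theorem abs_sub_le_mul_of_step {n : ℕ} (g : Fin n → ℝ) (K : ℝ)
    (h : ∀ (i : ℕ) (hi : i + 1 < n), |g ⟨i + 1, hi⟩ - g ⟨i, by omega⟩| ≤ K) (a b : Fin n) :
    |g a - g b| ≤ K * ((|(a : ℤ) - (b : ℤ)| : ℤ) : ℝ) := by
  have key : ∀ (d i : ℕ) (hi : i + d < n), |g ⟨i + d, hi⟩ - g ⟨i, by omega⟩| ≤ K * d := by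
    intro d i
    induction d with
    | zero => simp
    | succ d ih =>
      intro hi
      have h1 := ih (by omega)
      have h2 := h (i + d) hi
      have h3 := abs_sub_le (g ⟨i + d + 1, hi⟩) (g ⟨i + d, by omega⟩) (g ⟨i, by omega⟩)
      push_cast
      change |g ⟨i + d + 1, hi⟩ - _| ≤ _
      linarith
  have mono : ∀ a b : Fin n, (b : ℕ) ≤ a →
      |g a - g b| ≤ K * ((|(a : ℤ) - (b : ℤ)| : ℤ) : ℝ) := by
    intro a b hab
    obtain ⟨d, hd⟩ := Nat.exists_eq_add_of_le hab
    have h1 := key d b (hd ▸ a.2)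
    have ha : a = ⟨b + d, hd ▸ a.2⟩ := Fin.ext hd
    rw [ha]
    simpa using h1
  rcases le_total (b : ℕ) a with hab | hab
  · exact mono a b hab
  · rw [abs_sub_comm, abs_sub_comm (a : ℤ)]
    exact mono b a hab

theorem entry_zero {a b : ℕ} (p q : ℤ) : entry (0 : Fin a → Fin b → ℝ) p q = 0 := by
  simp [entry]

theorem entry_indicator {a b : ℕ} (i : Fin a) (j : Fin b) (p q : ℤ) :
    entry (fun i' j' => if i' = i ∧ j' = j then 1 else 0) p q
      = if p = i ∧ q = j then 1 else 0 := by
  unfold entry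
  split_ifs <;> simp_all [Fin.ext_iff]
  omega

section Incidence

variable {n m : ℕ} {R : Fin n × Fin m → ℝ} {A : Matrix (Fin n × Fin m) (FlowIdx n m) ℝ}

theorem matrix_apply_of_flat_eq_single (hA : ∀ δ : Flow n m, applyFlow R δ = R + A.mulVec (flat δ))
    {k : FlowIdx n m} {δ : Flow n m} (hδ : flat δ = Pi.single k 1) (x : Fin n × Fin m) :
    A x k = applyFlow R δ x - R x := by
  simp [hA, hδ]

theorem sum_mul_horizontal (hA : ∀ δ : Flow n m, applyFlow R δ = R + A.mulVec (flat δ))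
    (f : Fin n × Fin m → ℝ) (i : Fin n) (j : ℕ) (hj : j + 1 < m) :
    ∑ x, f x * A x (Sum.inl (i, ⟨j, by omega⟩)) = f (i, ⟨j + 1, hj⟩) - f (i, ⟨j, by omega⟩) := by
  have hcol : ∀ x, A x (Sum.inl (i, ⟨j, by omega⟩))
      = (if x = (i, ⟨j + 1, hj⟩) then 1 else 0) - (if x = (i, ⟨j, by omega⟩) then 1 else 0) := by
    intro x
    rw [matrix_apply_of_flat_eq_single hA
      (δ := (fun i' j' => if i' = i ∧ j' = ⟨j, by omega⟩ then 1 else 0, 0))]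
    · have hshift : ((x.2 : ℤ) - 1 = j) ↔ (x.2 : ℕ) = j + 1 := by omega
      simp only [applyFlow, entry_zero, entry_indicator]
      simp only [Prod.ext_iff, Fin.ext_iff, Nat.cast_inj, hshift]
      ring
    · ext (p | p) <;> simp [flat, Pi.single_apply, Prod.ext_iff]
  simp [hcol, mul_sub, Finset.sum_sub_distrib]

theorem sum_mul_vertical (hA : ∀ δ : Flow n m, applyFlow R δ = R + A.mulVec (flat δ))
    (f : Fin n × Fin m → ℝ) (j : Fin m) (i : ℕ) (hi : i + 1 < n) :
    ∑ x, f x * A x (Sum.inr (⟨i, by omega⟩, j)) = f (⟨i + 1, hi⟩, j) - f (⟨i, by omega⟩, j) := by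
  have hcol : ∀ x, A x (Sum.inr (⟨i, by omega⟩, j))
      = (if x = (⟨i + 1, hi⟩, j) then 1 else 0) - (if x = (⟨i, by omega⟩, j) then 1 else 0) := by
    intro x
    rw [matrix_apply_of_flat_eq_single hA
      (δ := (0, fun i' j' => if i' = ⟨i, by omega⟩ ∧ j' = j then 1 else 0))]
    · have hshift : ((x.1 : ℤ) - 1 = i) ↔ (x.1 : ℕ) = i + 1 := by omega
      simp only [applyFlow, entry_zero, entry_indicator]
      simp only [Prod.ext_iff, Fin.ext_iff, Nat.cast_inj, hshift]
      ring
    · ext (p | p) <;> simp [flat, Pi.single_apply, Prod.ext_iff]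
  simp [hcol, mul_sub, Finset.sum_sub_distrib]

theorem abs_sub_le_mul_gd (hA : ∀ δ : Flow n m, applyFlow R δ = R + A.mulVec (flat δ))
    (f : Fin n × Fin m → ℝ) (K : ℝ) (hK : ∀ k, |∑ x, f x * A x k| ≤ K) (x y : Fin n × Fin m) :
    |f x - f y| ≤ K * gd x y := by
  have h1 := abs_sub_le_mul_of_step (fun i => f (i, x.2)) K
    (fun i hi => by
      simpa only [sum_mul_vertical hA f x.2 i hi] using
        hK (Sum.inr (⟨i, by omega⟩, x.2)))
    x.1 y.1
  have h2 := abs_sub_le_mul_of_step (fun j => f (y.1, j)) K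
    (fun j hj => by
      simpa only [sum_mul_horizontal hA f y.1 j hj] using
        hK (Sum.inl (y.1, ⟨j, by omega⟩)))
    x.2 y.2
  have h3 := abs_sub_le (f x) (f (y.1, x.2)) (f y)
  simp only [gd, Int.cast_add, mul_add]
  exact h3.trans (add_le_add h1 h2)

end Incidence

theorem isCoupling_prod {n m : ℕ} {μ ν : Fin n × Fin m → ℝ} (hμ : IsProbDist μ)
    (hν : IsProbDist ν) : IsCoupling μ ν (fun p => μ p.1 * ν p.2) :=
  ⟨fun p => mul_nonneg (hμ.1 _) (hν.1 _), fun x => by simp [← Finset.mul_sum, hν.2],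
    fun y => by simp [← Finset.sum_mul, hμ.2]⟩

/-- The easy direction of Kantorovich duality, for a single coupling. -/
theorem IsCoupling.sum_sub_sum_le {n m : ℕ} {μ ν : Fin n × Fin m → ℝ}
    {π : (Fin n × Fin m) × (Fin n × Fin m) → ℝ} (hπ : IsCoupling μ ν π)
    {f : Fin n × Fin m → ℝ} {K : ℝ} (hf : ∀ x y, |f x - f y| ≤ K * gd x y) :
    ∑ x, f x * μ x - ∑ x, f x * ν x ≤ K * ∑ p, gd p.1 p.2 * π p := by
  obtain ⟨h0, h1, h2⟩ := hπ
  have e1 : ∑ x, f x * μ x = ∑ p, f p.1 * π p := by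
    simp [Fintype.sum_prod_type (fun p : (Fin n × Fin m) × (Fin n × Fin m) => f p.1 * π p),
      ← h1, Finset.mul_sum]
  have e2 : ∑ x, f x * ν x = ∑ p, f p.2 * π p := by
    simp [Fintype.sum_prod_type_right (fun p : (Fin n × Fin m) × (Fin n × Fin m) => f p.2 * π p),
      ← h2, Finset.mul_sum]
  rw [e1, e2, ← Finset.sum_sub_distrib, Finset.mul_sum]
  refine Finset.sum_le_sum fun p _ => ?_
  rw [← sub_mul, ← mul_assoc]
  exact mul_le_mul_of_nonneg_right ((le_abs_self _).trans (hf _ _)) (h0 p)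

/-- `L¹` perturbation solution for linear classifiers: with
`w_t = (WA)_y − (WA)_t`, `d_t = (WR+b)_y − (WR+b)_t` and
`ε = min_{t≠y} |w_tᵀδ^μ + d_t| / ‖w_t‖_∞`, every probability distribution `ν`
with `W₁(μ, ν) < ε` is classified as `y`. -/
theorem l1_perturbation_linear (n m C : ℕ)
    (W : Matrix (Fin C) (Fin n × Fin m) ℝ) (b : Fin C → ℝ)
    (μ : Fin n × Fin m → ℝ) (hμ : IsProbDist μ)
    (y : Fin C) (hy : ∀ t, (W.mulVec μ + b) t ≤ (W.mulVec μ + b) y)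
    (R : Fin n × Fin m → ℝ) (hR : IsProbDist R)
    (A : Matrix (Fin n × Fin m) (FlowIdx n m) ℝ)
    (hA : ∀ δ : Flow n m, applyFlow R δ = R + A.mulVec (flat δ))
    (δμ : Flow n m) (hδμ : applyFlow R δμ = μ)
    (hw : ∀ t, t ≠ y → (fun k => (W * A) y k - (W * A) t k) ≠ 0)
    (ε : ℝ)
    (hε : ε = sInf {r | ∃ t, t ≠ y ∧
      r = |(∑ k, ((W * A) y k - (W * A) t k) * flat δμ k) +
            ((W.mulVec R + b) y - (W.mulVec R + b) t)| /
          (⨆ k, |(W * A) y k - (W * A) t k|)}) :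
    ∀ ν : Fin n × Fin m → ℝ, IsProbDist ν → W1 μ ν < ε →
      ∀ t, (W.mulVec ν + b) t ≤ (W.mulVec ν + b) y := by
  intro ν hν hW t
  rcases eq_or_ne t y with rfl | ht
  · exact le_rfl
  set K := ⨆ k, |(W * A) y k - (W * A) t k| with hKdef
  have hK : ∀ k, |(W * A) y k - (W * A) t k| ≤ K :=
    le_ciSup (f := fun k => |(W * A) y k - (W * A) t k|) (Set.finite_range _).bddAbove
  have hKpos : 0 < K := by
    obtain ⟨k, hk⟩ := Function.ne_iff.mp (hw t ht)
    exact (abs_pos.mpr hk).trans_le (hK k)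
  have hmargin : (∑ k, ((W * A) y k - (W * A) t k) * flat δμ k) +
      ((W.mulVec R + b) y - (W.mulVec R + b) t) =
      (W.mulVec μ + b) y - (W.mulVec μ + b) t := by
    rw [← hδμ, hA, Matrix.mulVec_add, Matrix.mulVec_mulVec]
    simp only [Pi.add_apply, sub_mul, Finset.sum_sub_distrib, Matrix.mulVec, dotProduct]
    ring
  have hεle : ε ≤ ((W.mulVec μ + b) y - (W.mulVec μ + b) t) / K := by
    rw [hε, ← abs_of_nonneg (sub_nonneg.mpr (hy t)), ← hmargin]
    refine csInf_le ⟨0, ?_⟩ ⟨t, ht, rfl⟩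
    rintro r ⟨s, -, rfl⟩
    exact div_nonneg (abs_nonneg _) (Real.iSup_nonneg fun k => abs_nonneg _)
  obtain ⟨c, ⟨π, hπ, rfl⟩, hc⟩ := exists_lt_of_csInf_lt (α := ℝ)
    (by exact ⟨_, _, isCoupling_prod hμ hν, rfl⟩) (hW.trans_le hεle)
  have hlip := abs_sub_le_mul_gd hA (fun x => W y x - W t x) K fun k => by
    simpa [Matrix.mul_apply, sub_mul, Finset.sum_sub_distrib] using hK k
  have hdual := hπ.sum_sub_sum_le hlip
  rw [lt_div_iff₀ hKpos, mul_comm] at hc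
  simp only [sub_mul, Finset.sum_sub_distrib] at hdual
  simp only [Pi.add_apply, Matrix.mulVec, dotProduct] at hc ⊢
  linarith


end WassersteinFlow
end
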